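/- Let p < q be odd primes with gcd(p-1,q-1) = d and N = pq, and let {s_i} be the modified Jacobi sequence of period N. Then gcd(S(2), 2^N - 1) divides (2^p - 1)(2^q - 1), and consequently the 2-adic complexity φ_2(s) = ⌊log_2((2^N-1)/gcd(2^N-1, S(2)))⌋ satisfies φ_2(s) ≥ pq - p - q - 1. -/

import Mathlib

theorem aux_prim (p : ℕ) [Fact p.Prime] (g : ZMod p) (hp2 : 2 < p) (hg : orderOf g = p - 1) :
    g ≠ 0 ∧ ∀ y : ZMod p, y ≠ 0 → ∃ k : ℕ, g ^ k = y := by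
  have hg0 : g ≠ 0 := by
    rintro rfl
    rw [orderOf_zero] at hg
    omega
  refine ⟨hg0, ?_⟩
  have himg : (Finset.range (p - 1)).image (fun k => g ^ k) = Finset.univ.erase 0 := by
    apply Finset.eq_of_subset_of_card_le
    · intro y hy
      simp only [Finset.mem_image] at hy
      obtain ⟨k, -, rfl⟩ := hy
      simp [hg0]
    · rw [Finset.card_erase_of_mem (Finset.mem_univ _), Finset.card_univ, ZMod.card,
        Finset.card_image_of_injOn, Finset.card_range]
      intro a ha b hb hab
      rw [← hg] at ha hb
      exact pow_injOn_Iio_orderOf (by simpa using ha) (by simpa using hb) hab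
  intro y hy
  have : y ∈ Finset.univ.erase (0 : ZMod p) := by simp [hy]
  rw [← himg] at this
  simp only [Finset.mem_image] at this
  obtain ⟨k, -, hk⟩ := this
  exact ⟨k, hk⟩

theorem aux_char (p : ℕ) [Fact p.Prime] (g : ZMod p) (hp2 : 2 < p) (hg : orderOf g = p - 1) :
    quadraticChar (ZMod p) g = -1 := by
  obtain ⟨hg0, hgen⟩ := aux_prim p g hp2 hg
  obtain ⟨a, ha⟩ := quadraticChar_exists_neg_one (F := ZMod p)
    (by rw [ZMod.ringChar_zmod_n]; omega)
  have ha0 : a ≠ 0 := by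
    rintro rfl
    simp at ha
  obtain ⟨k, rfl⟩ := hgen a ha0
  rcases quadraticChar_dichotomy hg0 with h | h
  · rw [map_pow, h] at ha
    simp at ha
  · exact h

theorem aux_mem (p q : ℕ) [Fact p.Prime] [Fact q.Prime] (hp2 : 2 < p) (hq2 : 2 < q)
    (hop : Odd p) (hoq : Odd q)
    (hne : p ≠ q) (g : ℕ) (hgp : orderOf (g : ZMod p) = p - 1)
    (hgq : orderOf (g : ZMod q) = q - 1)
    (x : ℕ) (hxp : (x : ZMod p) = (g : ZMod p)) (hxq : (x : ZMod q) = 1) (n : ℕ) :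
    (n : ZMod (p * q)) ∈ (Finset.range (Nat.gcd (p - 1) (q - 1) / 2)).biUnion (fun i =>
      (Finset.range ((p - 1) * (q - 1) / Nat.gcd (p - 1) (q - 1))).image
      (fun t => (g : ZMod (p * q)) ^ t * (x : ZMod (p * q)) ^ (2 * i + 1))) ↔
    quadraticChar (ZMod p) n * quadraticChar (ZMod q) n = -1 := by
  have hcop : p.Coprime q := (Nat.coprime_primes Fact.out Fact.out).2 hne
  have key : ∀ t j : ℕ, (g : ZMod (p * q)) ^ t * (x : ZMod (p * q)) ^ j = (n : ZMod (p * q)) ↔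
      ((g : ZMod p) ^ (t + j) = n ∧ (g : ZMod q) ^ t = n) := by
    intro t j
    have h1 : (g : ZMod (p * q)) ^ t * (x : ZMod (p * q)) ^ j = ((g ^ t * x ^ j : ℕ) : ZMod (p * q)) := by
      push_cast; rfl
    rw [h1, ZMod.natCast_eq_natCast_iff, ← Nat.modEq_and_modEq_iff_modEq_mul hcop,
      ← ZMod.natCast_eq_natCast_iff, ← ZMod.natCast_eq_natCast_iff]
    push_cast
    rw [hxp, hxq, one_pow, mul_one, pow_add]
  obtain ⟨hgp0, hgenp⟩ := aux_prim p g hp2 hgp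
  obtain ⟨hgq0, hgenq⟩ := aux_prim q g hq2 hgq
  have cp := aux_char p g hp2 hgp
  have cq := aux_char q g hq2 hgq
  simp only [Finset.mem_biUnion, Finset.mem_image, Finset.mem_range, key]
  constructor
  · rintro ⟨i, -, t, -, h1, h2⟩
    rw [← h1, ← h2, map_pow, map_pow, cp, cq, ← pow_add]
    exact Odd.neg_one_pow ⟨t + i, by ring⟩
  · intro h
    have hn1 : (n : ZMod p) ≠ 0 := by
      intro h0; rw [h0] at h; simp at h
    have hn2 : (n : ZMod q) ≠ 0 := by
      intro h0; rw [h0] at h; simp at h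
    obtain ⟨a, ha⟩ := hgenp _ hn1
    obtain ⟨b, hb⟩ := hgenq _ hn2
    rw [← ha, ← hb, map_pow, map_pow, cp, cq, ← pow_add] at h
    have hodd : Odd (a + b) := by
      rcases Nat.even_or_odd (a + b) with h' | h'
      · rw [h'.neg_one_pow] at h; norm_num at h
      · exact h'
    have hd2 : 2 ∣ Nat.gcd (p - 1) (q - 1) := by
      apply Nat.dvd_gcd
      · obtain ⟨k, hk⟩ := hop; omega
      · obtain ⟨k, hk⟩ := hoq; omega
    have hdpos : 0 < Nat.gcd (p - 1) (q - 1) := Nat.gcd_pos_of_pos_left _ (by omega)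
    have hlcm : (p - 1) * (q - 1) / Nat.gcd (p - 1) (q - 1) = Nat.lcm (p - 1) (q - 1) := rfl
    rw [hlcm]
    have hdp : Nat.gcd (p - 1) (q - 1) ∣ p - 1 := Nat.gcd_dvd_left _ _
    obtain ⟨d, hd⟩ : ∃ d, d = Nat.gcd (p - 1) (q - 1) := ⟨_, rfl⟩
    rw [← hd] at hd2 hdpos hdp ⊢
    obtain ⟨e, rfl⟩ := hd2
    obtain ⟨j, hj⟩ : ∃ j, j = (a + b * (2 * e - 1)) % (2 * e) := ⟨_, rfl⟩
    have hjlt : j < 2 * e := hj ▸ Nat.mod_lt _ hdpos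
    have hje : j + b ≡ a [MOD (2 * e)] := by
      have h1 : j ≡ a + b * (2 * e - 1) [MOD (2 * e)] := by
        rw [hj]; exact Nat.mod_modEq _ _
      have h2 : a + b * (2 * e - 1) + b = a + (2 * e) * b := by
        have : b * (2 * e - 1) + b = (2 * e) * b := by
          obtain ⟨m, hm⟩ : ∃ m, 2 * e = m + 1 := ⟨2 * e - 1, by omega⟩
          rw [hm]; simp; ring
        omega
      have h3 := h1.add_right b
      rw [h2] at h3
      exact h3.trans (by simp [Nat.ModEq])
    have hjodd : j % 2 = 1 := by
      have h1 : j + b ≡ a [MOD 2] := hje.of_mul_right e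
      unfold Nat.ModEq at h1
      obtain ⟨k, hk⟩ := hodd
      omega
    have hsum : a + (p - 2) * j + j = a + (p - 1) * j := by
      obtain ⟨m, rfl⟩ : ∃ m, p = m + 2 := ⟨p - 2, by omega⟩
      have : m + 2 - 1 = m + 1 := rfl
      rw [this]; simp; ring
    have hcomp : a + (p - 2) * j ≡ b [MOD Nat.gcd (p - 1) (q - 1)] := by
      rw [← hd]
      apply Nat.ModEq.add_right_cancel' j
      rw [hsum, add_comm b j]
      refine Nat.ModEq.trans ?_ hje.symm
      obtain ⟨m, hm⟩ := hdp
      rw [hm, mul_assoc]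
      simp [Nat.ModEq]
    have hlt := Nat.chineseRemainder'_lt_lcm hcomp (by omega) (by omega)
    obtain ⟨ht1, ht2⟩ := (Nat.chineseRemainder' hcomp).2
    refine ⟨j / 2, by omega, _, hlt, ?_, ?_⟩
    · have : 2 * (j / 2) + 1 = j := by omega
      rw [this, ← ha]
      apply pow_eq_pow_of_modEq _ (n := p - 1) (by rw [← hgp]; exact pow_orderOf_eq_one _)
      refine (ht1.add_right j).trans ?_
      rw [hsum]
      simp [Nat.ModEq]
    · rw [← hb]
      exact pow_eq_pow_of_modEq ht2 (by rw [← hgq]; exact pow_orderOf_eq_one _)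

/-- Membership in `P`. -/
theorem aux_memP (p q : ℕ) [Fact p.Prime] [Fact q.Prime] (hne : p ≠ q) (n : ℕ) :
    (n : ZMod (p * q)) ∈ (Finset.Icc 1 (q - 1)).image (fun k => ((k * p : ℕ) : ZMod (p * q))) ↔
    (n : ZMod p) = 0 ∧ (n : ZMod q) ≠ 0 := by
  have hcop : p.Coprime q := (Nat.coprime_primes Fact.out Fact.out).2 hne
  have hqp : (p : ZMod q) ≠ 0 := by
    rw [Ne, ZMod.natCast_eq_zero_iff]
    intro h
    exact hne ((Nat.prime_dvd_prime_iff_eq Fact.out Fact.out).1 h).symm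
  have hq := (Fact.out : q.Prime)
  simp only [Finset.mem_image, Finset.mem_Icc]
  have key : ∀ k : ℕ, ((k * p : ℕ) : ZMod (p * q)) = n ↔
      ((n : ZMod p) = 0 ∧ (k : ZMod q) * p = n) := by
    intro k
    rw [ZMod.natCast_eq_natCast_iff, ← Nat.modEq_and_modEq_iff_modEq_mul hcop,
      ← ZMod.natCast_eq_natCast_iff, ← ZMod.natCast_eq_natCast_iff]
    push_cast
    rw [ZMod.natCast_self, mul_zero, eq_comm]
  simp only [key]
  constructor
  · rintro ⟨k, ⟨h1, h2⟩, h3, h4⟩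
    refine ⟨h3, ?_⟩
    rw [← h4]
    refine mul_ne_zero ?_ hqp
    rw [Ne, ZMod.natCast_eq_zero_iff]
    intro h
    have := Nat.le_of_dvd (by omega) h
    have := hq.two_le
    omega
  · rintro ⟨h1, h2⟩
    refine ⟨((n : ZMod q) * (p : ZMod q)⁻¹).val, ⟨?_, ?_⟩, h1, ?_⟩
    · rw [Nat.one_le_iff_ne_zero, Ne, ZMod.val_eq_zero]
      exact mul_ne_zero h2 (inv_ne_zero hqp)
    · have := ZMod.val_lt ((n : ZMod q) * (p : ZMod q)⁻¹)
      omega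
    · rw [ZMod.natCast_zmod_val, mul_assoc, inv_mul_cancel₀ hqp, mul_one]

theorem aux_reindex (p q : ℕ) [Fact p.Prime] [Fact q.Prime] (hne : p ≠ q)
    {F : Type*} [AddCommMonoid F] (f : ℕ → F) (hf : ∀ i, f (i % (p * q)) = f i) :
    ∑ i ∈ Finset.range (p * q), f i =
      ∑ a : ZMod p, ∑ b : ZMod q, f (a.val * q + b.val * p) := by
  have hcop : p.Coprime q := (Nat.coprime_primes Fact.out Fact.out).2 hne
  have hp := (Fact.out : p.Prime)
  have hq := (Fact.out : q.Prime)
  have hqp : (p : ZMod q) ≠ 0 := by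
    rw [Ne, ZMod.natCast_eq_zero_iff]
    intro h
    exact hne ((Nat.prime_dvd_prime_iff_eq Fact.out Fact.out).1 h).symm
  have hpq : (q : ZMod p) ≠ 0 := by
    rw [Ne, ZMod.natCast_eq_zero_iff]
    intro h
    exact hne ((Nat.prime_dvd_prime_iff_eq Fact.out Fact.out).1 h)
  rw [← Fintype.sum_prod_type' (f := fun (a : ZMod p) (b : ZMod q) => f (a.val * q + b.val * p))]
  have hinj : Function.Injective
      (fun ab : ZMod p × ZMod q => (ab.1.val * q + ab.2.val * p) % (p * q)) := by
    rintro ⟨a, b⟩ ⟨a', b'⟩ h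
    have h : a.val * q + b.val * p ≡ a'.val * q + b'.val * p [MOD p * q] := h
    rw [← Nat.modEq_and_modEq_iff_modEq_mul hcop,
      ← ZMod.natCast_eq_natCast_iff, ← ZMod.natCast_eq_natCast_iff] at h
    obtain ⟨h1, h2⟩ := h
    push_cast at h1 h2
    simp only [ZMod.natCast_self, mul_zero, add_zero, zero_add, ZMod.natCast_zmod_val] at h1 h2
    rw [mul_left_inj' hpq] at h1
    rw [mul_left_inj' hqp] at h2
    rw [h1, h2]
  have himg : Finset.univ.image
      (fun ab : ZMod p × ZMod q => (ab.1.val * q + ab.2.val * p) % (p * q)) =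
      Finset.range (p * q) := by
    apply Finset.eq_of_subset_of_card_le
    · intro y hy
      simp only [Finset.mem_image] at hy
      obtain ⟨k, -, rfl⟩ := hy
      exact Finset.mem_range.2 (Nat.mod_lt _ (Nat.mul_pos hp.pos hq.pos))
    · rw [Finset.card_image_of_injective _ hinj]
      simp [ZMod.card]
  rw [← himg, Finset.sum_image (fun _ _ _ _ h => hinj h)]
  simp [hf]

theorem aux_gauss (p r : ℕ) [Fact p.Prime] [Fact r.Prime] (hp2 : 2 < p) (hr2 : 2 < r)
    (u : ZMod r) (hu : u ^ p = 1) :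
    ∃ G : ZMod r, G = ∑ a : ZMod p, ((quadraticChar (ZMod p) a : ℤ) : ZMod r) * u ^ a.val ∧
      (u = 1 → G = 0) ∧ (u ≠ 1 → G ^ 2 = p ∨ G ^ 2 = -p) := by
  have hc : ringChar (ZMod p) ≠ 2 := by rw [ZMod.ringChar_zmod_n]; omega
  have hχ : (quadraticChar (ZMod p)).ringHomComp (Int.castRingHom (ZMod r)) ≠ 1 := by
    obtain ⟨a, ha⟩ := quadraticChar_exists_neg_one hc
    intro h
    have ha0 : IsUnit a := by
      rw [isUnit_iff_ne_zero]
      rintro rfl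
      simp at ha
    have h1 := congrArg (fun χ => χ a) h
    simp only [MulChar.ringHomComp_apply, ha, MulChar.one_apply ha0] at h1
    have : ringChar (ZMod r) ≠ 2 := by rw [ZMod.ringChar_zmod_n]; omega
    apply Ring.neg_one_ne_one_of_char_ne_two this
    simpa using h1
  refine ⟨_, rfl, ?_, ?_⟩
  · rintro rfl
    have := MulChar.sum_eq_zero_of_ne_one hχ
    simpa using this
  · intro hu1
    have hψ : (AddChar.zmodChar p hu).IsPrimitive := by
      apply AddChar.IsPrimitive.of_ne_one
      intro h
      apply hu1
      have h1 := congrArg (fun ψ => ψ 1) h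
      simp only [AddChar.zmodChar_apply, AddChar.one_apply] at h1
      have : Fact (1 < p) := ⟨by omega⟩
      rwa [ZMod.val_one, pow_one] at h1
    have h := gaussSum_sq hχ ((quadraticChar_isQuadratic (ZMod p)).comp _) hψ
    simp only [gaussSum, MulChar.ringHomComp_apply, AddChar.zmodChar_apply, ZMod.card,
      eq_intCast] at h
    rw [h]
    rcases quadraticChar_dichotomy (F := ZMod p) (a := -1) (by simp) with h | h <;> simp [h]

theorem aux_geom (p r : ℕ) [Fact p.Prime] (u : ZMod r) :
    ∑ a : ZMod p, u ^ a.val = ∑ i ∈ Finset.range p, u ^ i := by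
  apply Finset.sum_nbij (fun a : ZMod p => a.val)
  · intro a _
    exact Finset.mem_range.2 (ZMod.val_lt a)
  · intro a _ b _ h
    exact ZMod.val_injective p h
  · intro i hi
    refine ⟨(i : ZMod p), by simp, ZMod.val_cast_of_lt (by simpa using hi)⟩
  · intros; rfl

theorem aux_main (p q r : ℕ) [Fact p.Prime] [Fact q.Prime] [Fact r.Prime]
    (hp2 : 2 < p) (hq2 : 2 < q) (hr2 : 2 < r) (hne : p ≠ q) (hop : Odd p) (hoq : Odd q)
    (hpow : (2 : ZMod r) ^ (p * q) = 1)
    (hA : ∑ i ∈ Finset.range q, ((2 : ZMod r) ^ p) ^ i = 0)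
    (hB : ∑ i ∈ Finset.range p, ((2 : ZMod r) ^ q) ^ i = 0)
    (M : ℕ → Prop) [DecidablePred M]
    (hM : ∀ n : ℕ, M n ↔ (quadraticChar (ZMod p) n * quadraticChar (ZMod q) n = -1 ∨
      ((n : ZMod p) = 0 ∧ (n : ZMod q) ≠ 0)))
    (hS : ∑ i ∈ Finset.range (p * q), (if M i then 1 else 0) * (2 : ZMod r) ^ i = 0) : False := by
  have hqp : (p : ZMod q) ≠ 0 := by
    rw [Ne, ZMod.natCast_eq_zero_iff]
    intro h
    exact hne ((Nat.prime_dvd_prime_iff_eq Fact.out Fact.out).1 h).symm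
  have hpq : (q : ZMod p) ≠ 0 := by
    rw [Ne, ZMod.natCast_eq_zero_iff]
    intro h
    exact hne ((Nat.prime_dvd_prime_iff_eq Fact.out Fact.out).1 h)
  have hcop : p.Coprime q := (Nat.coprime_primes Fact.out Fact.out).2 hne
  obtain ⟨c, hc⟩ : ∃ c : ℤ, c = quadraticChar (ZMod p) q * quadraticChar (ZMod q) p := ⟨_, rfl⟩
  have hc1 : c = 1 ∨ c = -1 := by
    rw [hc]
    rcases quadraticChar_dichotomy hpq with h | h <;>
    rcases quadraticChar_dichotomy hqp with h' | h' <;> simp [h, h']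
  obtain ⟨u, hu⟩ : ∃ u : ZMod r, u = 2 ^ q := ⟨_, rfl⟩
  obtain ⟨v, hv⟩ : ∃ v : ZMod r, v = 2 ^ p := ⟨_, rfl⟩
  have hup : u ^ p = 1 := by rw [hu, ← pow_mul, mul_comm, hpow]
  have hvq : v ^ q = 1 := by rw [hv, ← pow_mul, hpow]
  obtain ⟨G, hG, hG0, hG1⟩ := aux_gauss p r hp2 hr2 u hup
  obtain ⟨H, hH, hH0, hH1⟩ := aux_gauss q r hq2 hr2 v hvq
  rw [← hv, ← aux_geom q r] at hA
  rw [← hu, ← aux_geom p r] at hB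
  rw [aux_reindex p q hne] at hS
  swap
  · intro i
    have e1 : ((i % (p * q) : ℕ) : ZMod p) = i := by
      rw [ZMod.natCast_eq_natCast_iff]
      exact (Nat.mod_modEq i (p * q)).of_mul_right q
    have e2 : ((i % (p * q) : ℕ) : ZMod q) = i := by
      rw [ZMod.natCast_eq_natCast_iff]
      exact (Nat.mod_modEq i (p * q)).of_mul_left p
    have e3 : M (i % (p * q)) ↔ M i := by rw [hM, hM, e1, e2]
    have e4 : (2 : ZMod r) ^ (i % (p * q)) = 2 ^ i :=
      pow_eq_pow_of_modEq (Nat.mod_modEq i (p * q)) hpow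
    rw [e4]
    simp only [e3]
  have hterm : ∀ (a : ZMod p) (b : ZMod q),
      2 * ((if M (a.val * q + b.val * p) then 1 else 0) * (2 : ZMod r) ^ (a.val * q + b.val * p)) =
      (u ^ a.val - if a = 0 then 1 else 0) * (v ^ b.val - if b = 0 then 1 else 0)
      - c * ((((quadraticChar (ZMod p) a : ℤ) : ZMod r) * u ^ a.val) *
          (((quadraticChar (ZMod q) b : ℤ) : ZMod r) * v ^ b.val))
      + 2 * ((if a = 0 then 1 else 0) * (v ^ b.val - if b = 0 then 1 else 0)) := by
    intro a b
    have e1 : ((a.val * q + b.val * p : ℕ) : ZMod p) = a * q := by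
      push_cast; simp
    have e2 : ((a.val * q + b.val * p : ℕ) : ZMod q) = b * p := by
      push_cast; simp
    have e3 : (2 : ZMod r) ^ (a.val * q + b.val * p) = u ^ a.val * v ^ b.val := by
      rw [hu, hv, ← pow_mul, ← pow_mul, ← pow_add, mul_comm q, mul_comm p]
    have e4 : M (a.val * q + b.val * p) ↔
        (c * (quadraticChar (ZMod p) a * quadraticChar (ZMod q) b) = -1 ∨ (a = 0 ∧ b ≠ 0)) := by
      rw [hM, e1, e2, map_mul, map_mul, hc]
      have : quadraticChar (ZMod p) a * quadraticChar (ZMod p) q *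
        (quadraticChar (ZMod q) b * quadraticChar (ZMod q) p) =
        quadraticChar (ZMod p) q * quadraticChar (ZMod q) p *
        (quadraticChar (ZMod p) a * quadraticChar (ZMod q) b) := by ring
      rw [this]
      simp [hpq, hqp]
    rw [e3]
    simp only [e4]
    by_cases ha : a = 0
    · subst ha
      by_cases hb : b = 0
      · subst hb
        simp
      · simp [hb]
    · by_cases hb : b = 0
      · subst hb
        simp [ha]
      · rcases hc1 with h1 | h1 <;>
        rcases quadraticChar_dichotomy ha with h2 | h2 <;>
        rcases quadraticChar_dichotomy hb with h3 | h3 <;>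
        simp [ha, hb, h1, h2, h3] <;> ring
  have hsum : 0 = -1 - c * (G * H) := by
    have h1 := congrArg (fun z => 2 * z) hS
    simp only [Finset.mul_sum, hterm, mul_zero] at h1
    rw [← h1]
    simp only [Finset.sum_add_distrib, Finset.sum_sub_distrib, ← Finset.mul_sum, ← Finset.sum_mul]
    rw [← hG, ← hH, hA, hB]
    simp
    ring
  have hprod : (G * H) ^ 2 = 1 ∧ G ≠ 0 ∧ H ≠ 0 := by
    have h1 : (c : ZMod r) * (G * H) = -1 := by linear_combination hsum
    have hcc : (c : ZMod r) ^ 2 = 1 := by rcases hc1 with h | h <;> simp [h]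
    refine ⟨?_, ?_, ?_⟩
    · linear_combination (c * (G * H) - 1) * h1 - (G * H) ^ 2 * hcc
    · rintro h; rw [h] at h1; simp at h1
    · rintro h; rw [h] at h1; simp at h1
  obtain ⟨hGH, hGn, hHn⟩ := hprod
  have hu1 : u ≠ 1 := fun h => hGn (hG0 h)
  have hv1 : v ≠ 1 := fun h => hHn (hH0 h)
  have h20 : (2 : ZMod r) ≠ 0 := by
    intro h
    rw [h, zero_pow (by positivity)] at hpow
    simp at hpow
  have hup' : p ∣ r - 1 := by
    rw [← orderOf_eq_prime hup hu1]
    apply orderOf_dvd_of_pow_eq_one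
    exact ZMod.pow_card_sub_one_eq_one (by rw [hu]; exact pow_ne_zero _ h20)
  have hvq' : q ∣ r - 1 := by
    rw [← orderOf_eq_prime hvq hv1]
    apply orderOf_dvd_of_pow_eq_one
    exact ZMod.pow_card_sub_one_eq_one (by rw [hv]; exact pow_ne_zero _ h20)
  have hle := Nat.le_of_dvd (by omega) (hcop.mul_dvd_of_dvd_of_dvd hup' hvq')
  have hrodd : Odd r := (Fact.out : r.Prime).odd_of_ne_two (by omega)
  have hpqodd : Odd (p * q) := hop.mul hoq
  have hpqbig : 2 < p * q := by nlinarith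
  have hval : ((p * q : ℕ) : ZMod r) = (1 : ℕ) ∨ ((p * q + 1 : ℕ) : ZMod r) = 0 := by
    push_cast
    rw [mul_pow] at hGH
    rcases hG1 hu1 with h | h <;> rcases hH1 hv1 with h' | h' <;> rw [h, h'] at hGH
    · left; linear_combination hGH
    · right; linear_combination -hGH
    · right; linear_combination -hGH
    · left; linear_combination hGH
  rcases hval with h | h
  · rw [ZMod.natCast_eq_natCast_iff] at h
    have := (Nat.modEq_iff_dvd' (by omega)).1 h.symm
    have := Nat.le_of_dvd (by omega) this
    omega
  · rw [ZMod.natCast_eq_zero_iff] at h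
    have := Nat.le_of_dvd (by omega) h
    have : r = p * q + 1 := by omega
    rw [this] at hrodd
    rw [Nat.odd_add_one] at hrodd
    exact hrodd hpqodd


theorem stmt_19
    (p q : ℕ) (hp : p.Prime) (hq : q.Prime) (hop : Odd p) (hoq : Odd q)
    (hne : p ≠ q) (d : ℕ) (hd : d = Nat.gcd (p - 1) (q - 1))
    (g : ℕ) (hgp : orderOf (g : ZMod p) = p - 1) (hgq : orderOf (g : ZMod q) = q - 1)
    (x : ℕ) (hxp : (x : ZMod p) = (g : ZMod p)) (hxq : (x : ZMod q) = 1)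
    (L : ℕ) (hL : L = (p - 1) * (q - 1) / d)
    (D : ℕ → Finset (ZMod (p * q)))
    (hD : D = fun i => (Finset.range L).image
      (fun t => (g : ZMod (p * q)) ^ t * (x : ZMod (p * q)) ^ i))
    (Dstar : ℕ → Finset (ZMod (p * q)))
    (hDstar : Dstar = fun j => (Finset.range (d / 2)).biUnion (fun i => D (2 * i + j)))
    (P : Finset (ZMod (p * q)))
    (hP : P = (Finset.Icc 1 (q - 1)).image (fun k => ((k * p : ℕ) : ZMod (p * q))))
    (s : ℕ → ℕ)
    (hs : s = fun i : ℕ => if ((i : ℕ) : ZMod (p * q)) ∈ Dstar 1 ∪ P then 1 else 0)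
    (hlt : p < q)
    (S2 : ℕ) (hS2 : S2 = ∑ i ∈ Finset.range (p * q), s i * 2 ^ i) :
    Nat.gcd S2 (2 ^ (p * q) - 1) ∣ (2 ^ p - 1) * (2 ^ q - 1) ∧
      p * q - p - q - 1 ≤
        Nat.log 2 ((2 ^ (p * q) - 1) / Nat.gcd (2 ^ (p * q) - 1) S2) := by

  have : Fact p.Prime := ⟨hp⟩
  have : Fact q.Prime := ⟨hq⟩
  have hp2 : 2 < p := lt_of_le_of_ne hp.two_le (by rintro rfl; exact absurd hop (by decide))
  have hq2 : 2 < q := by omega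
  have hcop : p.Coprime q := (Nat.coprime_primes hp hq).2 hne
  have hM : ∀ n : ℕ, (n : ZMod (p * q)) ∈ Dstar 1 ∪ P ↔
      (quadraticChar (ZMod p) n * quadraticChar (ZMod q) n = -1 ∨
      ((n : ZMod p) = 0 ∧ (n : ZMod q) ≠ 0)) := by
    intro n
    subst hd hL hD hDstar hP
    exact (Finset.mem_union.trans (or_congr
      (aux_mem p q hp2 hq2 hop hoq hne g hgp hgq x hxp hxq n) (aux_memP p q hne n)))
  generalize Dstar 1 ∪ P = T at hs hM
  have hgeo : ∀ a b : ℕ, (2 ^ a - 1) * ∑ i ∈ Finset.range b, (2 ^ a) ^ i = 2 ^ (a * b) - 1 := by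
    intro a b
    have h1 : 1 ≤ 2 ^ a := Nat.one_le_two_pow
    have h2 : 1 ≤ 2 ^ (a * b) := Nat.one_le_two_pow
    zify [h1, h2]
    rw [mul_geom_sum, pow_mul]
  have hA := hgeo p q
  have hB := hgeo q p
  rw [mul_comm q p] at hB
  have hcop2 : (2 ^ p - 1).Coprime (2 ^ q - 1) := by
    rw [Nat.Coprime, Nat.pow_sub_one_gcd_pow_sub_one, hcop]
    rfl
  obtain ⟨K, hK⟩ : (2 ^ p - 1) * (2 ^ q - 1) ∣ 2 ^ (p * q) - 1 :=
    hcop2.mul_dvd_of_dvd_of_dvd ⟨_, hA.symm⟩ ⟨_, hB.symm⟩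
  have hp1 : 0 < 2 ^ p - 1 := Nat.sub_pos_of_lt (Nat.one_lt_two_pow hp.ne_zero)
  have hq1 : 0 < 2 ^ q - 1 := Nat.sub_pos_of_lt (Nat.one_lt_two_pow hq.ne_zero)
  have hKA : K ∣ ∑ i ∈ Finset.range q, (2 ^ p) ^ i := by
    refine ⟨2 ^ q - 1, Nat.eq_of_mul_eq_mul_left hp1 ?_⟩
    rw [hA, hK]; ring
  have hKB : K ∣ ∑ i ∈ Finset.range p, (2 ^ q) ^ i := by
    refine ⟨2 ^ p - 1, Nat.eq_of_mul_eq_mul_left hq1 ?_⟩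
    rw [hB, hK]; ring
  have hKS : Nat.Coprime K S2 := by
    apply Nat.Coprime.symm
    apply Nat.coprime_of_dvd
    intro r hr hrS hrK
    have : Fact r.Prime := ⟨hr⟩
    have hrM : r ∣ 2 ^ (p * q) - 1 := hrK.trans ⟨_, hK.trans (mul_comm _ _)⟩
    have hpow : (2 : ZMod r) ^ (p * q) = 1 := by
      have h := (ZMod.natCast_eq_zero_iff _ _).2 hrM
      rw [Nat.cast_sub Nat.one_le_two_pow] at h
      push_cast at h
      exact sub_eq_zero.1 h
    have hr2 : 2 < r := by
      refine lt_of_le_of_ne hr.two_le ?_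
      rintro rfl
      rw [show (2 : ZMod 2) = 0 from rfl, zero_pow (Nat.mul_ne_zero hp.ne_zero hq.ne_zero)] at hpow
      exact zero_ne_one hpow
    have hA' := (ZMod.natCast_eq_zero_iff _ _).2 (hrK.trans hKA)
    have hB' := (ZMod.natCast_eq_zero_iff _ _).2 (hrK.trans hKB)
    have hS' := (ZMod.natCast_eq_zero_iff _ _).2 hrS
    rw [hS2, hs] at hS'
    push_cast at hA' hB' hS'
    exact aux_main p q r hp2 hq2 hr2 hne hop hoq hpow hA' hB'
      (fun i => (i : ZMod (p * q)) ∈ T) hM hS'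
  have hdvd : Nat.gcd S2 (2 ^ (p * q) - 1) ∣ (2 ^ p - 1) * (2 ^ q - 1) := by
    rw [hK, Nat.Coprime.gcd_mul_right_cancel_right _ hKS]
    exact Nat.gcd_dvd_right _ _
  refine ⟨hdvd, ?_⟩
  rw [Nat.gcd_comm]
  have hMpos : 0 < 2 ^ (p * q) - 1 :=
    Nat.sub_pos_of_lt (Nat.one_lt_two_pow (Nat.mul_ne_zero hp.ne_zero hq.ne_zero))
  have hgpos : 0 < Nat.gcd S2 (2 ^ (p * q) - 1) := Nat.gcd_pos_of_pos_right _ hMpos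
  apply Nat.le_log_of_pow_le (by norm_num)
  rw [Nat.le_div_iff_mul_le hgpos]
  have hgle := Nat.le_of_dvd (Nat.mul_pos hp1 hq1) hdvd
  have hQ : (2 ^ p - 1) * (2 ^ q - 1) ≤ 2 ^ (p + q) := by
    rw [pow_add]
    exact Nat.mul_le_mul (Nat.sub_le _ _) (Nat.sub_le _ _)
  have hbig : p + q + 1 ≤ p * q := by nlinarith
  calc 2 ^ (p * q - p - q - 1) * Nat.gcd S2 (2 ^ (p * q) - 1)
      ≤ 2 ^ (p * q - p - q - 1) * 2 ^ (p + q) := Nat.mul_le_mul_left _ (hgle.trans hQ)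
    _ = 2 ^ (p * q - 1) := by
        rw [← pow_add]; congr 1; omega
    _ ≤ 2 ^ (p * q) - 1 := by
        have h1 : 2 ^ (p * q) = 2 * 2 ^ (p * q - 1) := by
          rw [← pow_succ']; congr 1; omega
        have h2 : 1 ≤ 2 ^ (p * q - 1) := Nat.one_le_two_pow
        omega
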